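/- For every integer n ≥ 3, if n is even there exists a proper colouring of the Mycielskian μ(W_{n+1}) of the wheel graph W_{n+1} using the four colours 1, 2, 3, 4 whose colouring mean equals (7n+14)/(4n+6) and whose colouring variance equals (11n²+62n+56)/(4n+6)²; if n is odd there exists a proper colouring of μ(W_{n+1}) using the five colours 1, 2, 3, 4, 5 whose colouring mean equals (7n+19)/(4n+6) and whose colouring variance equals (44n³+626n²+1292n+678)/(4n+6)³. -/

import Mathlib

open Finset

/-- The Mycielskian of a graph `G` on vertex set `V`: vertices are
`V ⊕ V ⊕ Unit` where `Sum.inl a` is the original vertex `v_a`,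
`Sum.inr (Sum.inl a)` is the shadow vertex `u_a`, and `Sum.inr (Sum.inr ())`
is the apex vertex `u`. -/
def mycielskian {V : Type*} (G : SimpleGraph V) : SimpleGraph (V ⊕ V ⊕ Unit) :=
  SimpleGraph.fromRel (fun x y =>
    match x, y with
    | Sum.inl a, Sum.inl b => G.Adj a b
    | Sum.inl a, Sum.inr (Sum.inl b) => G.Adj a b
    | Sum.inr (Sum.inl _), Sum.inr (Sum.inr _) => True
    | _, _ => False)

/-- `colClass c i` is the number of vertices receiving colour `i`. -/
def colClass {V : Type*} [Fintype V] (c : V → ℕ) (i : ℕ) : ℕ :=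
  (Finset.univ.filter (fun v => c v = i)).card

/-- The colouring mean of a colouring `c` using colours `1, …, k`. -/
def colMean {V : Type*} [Fintype V] (c : V → ℕ) (k : ℕ) : ℚ :=
  (∑ i ∈ Finset.Icc 1 k, (i : ℚ) * (colClass c i)) / (Fintype.card V : ℚ)

/-- The colouring variance of a colouring `c` using colours `1, …, k`. -/
def colVar {V : Type*} [Fintype V] (c : V → ℕ) (k : ℕ) : ℚ :=
  (∑ i ∈ Finset.Icc 1 k, (i : ℚ) ^ 2 * (colClass c i)) / (Fintype.card V : ℚ)
    - (colMean c k) ^ 2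

/-- The path graph `P_n` on `Fin n`. -/
def pathG (n : ℕ) : SimpleGraph (Fin n) :=
  SimpleGraph.fromRel (fun i j => (i : ℕ) + 1 = (j : ℕ))

/-- The wheel graph $W_{n+1}$: the cycle $C_n$ on `Fin n` together with a
central vertex `Sum.inr ()` adjacent to all cycle vertices. -/
def wheelG (n : ℕ) : SimpleGraph (Fin n ⊕ Unit) :=
  SimpleGraph.fromRel (fun x y =>
    match x, y with
    | Sum.inl i, Sum.inl j => ((i : ℕ) + 1) % n = (j : ℕ)
    | Sum.inl _, Sum.inr _ => True
    | _, _ => False)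

/-- Extend a colouring `g` of the rim of the wheel to the Mycielskian: the hub gets colour `k`,
every shadow vertex gets colour `1`, and the apex gets colour `2`. -/
def mycielskianWheelColouring {n : ℕ} (g : Fin n → ℕ) (k : ℕ) :
    (Fin n ⊕ Unit) ⊕ (Fin n ⊕ Unit) ⊕ Unit → ℕ :=
  Sum.elim (Sum.elim g fun _ => k) (Sum.elim (fun _ => 1) fun _ => 2)

lemma mycielskianWheelColouring_mem_Icc {n k : ℕ} {g : Fin n → ℕ} (hk : 2 ≤ k)
    (hg : ∀ i, 2 ≤ g i ∧ g i < k) (v) : mycielskianWheelColouring g k v ∈ Icc 1 k := by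
  rcases v with (i | _) | (_ | _)
  · have := hg i
    simp only [mycielskianWheelColouring, Sum.elim_inl, mem_Icc]
    lia
  all_goals
    simp only [mycielskianWheelColouring, Sum.elim_inl, Sum.elim_inr, mem_Icc]
    lia

lemma mycielskianWheelColouring_ne_of_adj {n k : ℕ} {g : Fin n → ℕ} (hk : 2 ≤ k)
    (hg : ∀ i, 2 ≤ g i ∧ g i < k)
    (hcycle : ∀ i j : Fin n, ((i : ℕ) + 1) % n = j → g i ≠ g j) (x y)
    (hxy : (mycielskian (wheelG n)).Adj x y) :
    mycielskianWheelColouring g k x ≠ mycielskianWheelColouring g k y := by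
  rcases x with (i | _) | ((i | _) | _) <;> rcases y with (j | _) | ((j | _) | _) <;>
    simp only [mycielskian, wheelG, SimpleGraph.fromRel_adj] at hxy <;>
    simp only [mycielskianWheelColouring, Sum.elim_inl, Sum.elim_inr] <;>
    grind

lemma sum_mul_colClass {V : Type*} [Fintype V] {c : V → ℕ} {k : ℕ}
    (hc : ∀ v, c v ∈ Icc 1 k) (f : ℕ → ℚ) :
    ∑ i ∈ Icc 1 k, f i * colClass c i = ∑ v, f (c v) := by
  rw [← sum_fiberwise_of_maps_to (s := univ) (t := Icc 1 k) (g := c) fun v _ => hc v]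
  refine sum_congr rfl fun i _ => ?_
  rw [sum_congr rfl fun v hv => congrArg f (mem_filter.mp hv).2, sum_const, nsmul_eq_mul,
    mul_comm, colClass]

lemma sum_mul_colClass_mycielskianWheelColouring {n k : ℕ} {g : Fin n → ℕ} (hk : 2 ≤ k)
    (hg : ∀ i, 2 ≤ g i ∧ g i < k) (f : ℕ → ℚ) :
    ∑ i ∈ Icc 1 k, f i * colClass (mycielskianWheelColouring g k) i =
      ∑ i, f (g i) + f k + (n + 1) * f 1 + f 2 := by
  rw [sum_mul_colClass (mycielskianWheelColouring_mem_Icc hk hg)]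
  simp only [Fintype.sum_sum_type, mycielskianWheelColouring, Sum.elim_inl, Sum.elim_inr,
    sum_const, card_univ, Fintype.card_sum, Fintype.card_fin, Fintype.card_unit,
    nsmul_eq_mul]
  push_cast
  ring

lemma sum_range_two_mul_alternating (f : ℕ → ℚ) (m : ℕ) :
    ∑ i ∈ range (2 * m), f (2 + i % 2) = m * (f 2 + f 3) := by
  induction m with
  | zero => simp
  | succ m ih =>
    rw [Nat.mul_succ, sum_range_succ, sum_range_succ, ih, Nat.mul_mod_right,
      Nat.mul_add_mod]
    push_cast
    ring

lemma sum_range_alternating_last (f : ℕ → ℚ) (m : ℕ) :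
    ∑ i ∈ range (2 * m + 1), f (if i = 2 * m then 4 else 2 + i % 2) =
      m * (f 2 + f 3) + f 4 := by
  rw [sum_range_succ, if_pos rfl, ← sum_range_two_mul_alternating]
  congr 1
  exact sum_congr rfl fun i hi => by rw [if_neg (mem_range.mp hi).ne]

lemma card_mycielskian_wheel (n : ℕ) :
    (Fintype.card ((Fin n ⊕ Unit) ⊕ (Fin n ⊕ Unit) ⊕ Unit) : ℚ) = 2 * n + 3 := by
  simp only [Fintype.card_sum, Fintype.card_fin, Fintype.card_unit]
  push_cast
  ring

/-- The $χ$-chromatic mean and variance of the Mycielskian of the wheel $W_{n+1}$. -/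
theorem chi_chromatic_parameters_mycielskian_wheel (n : ℕ) (hn : 3 ≤ n) :
    (Even n →
      ∃ c : ((Fin n ⊕ Unit) ⊕ (Fin n ⊕ Unit) ⊕ Unit) → ℕ,
        (∀ v, c v ∈ Finset.Icc 1 4) ∧
        (∀ x y, (mycielskian (wheelG n)).Adj x y → c x ≠ c y) ∧
        colMean c 4 = (7 * (n : ℚ) + 14) / (4 * (n : ℚ) + 6) ∧
        colVar c 4 = (11 * (n : ℚ) ^ 2 + 62 * (n : ℚ) + 56) / (4 * (n : ℚ) + 6) ^ 2) ∧
    (Odd n →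
      ∃ c : ((Fin n ⊕ Unit) ⊕ (Fin n ⊕ Unit) ⊕ Unit) → ℕ,
        (∀ v, c v ∈ Finset.Icc 1 5) ∧
        (∀ x y, (mycielskian (wheelG n)).Adj x y → c x ≠ c y) ∧
        colMean c 5 = (7 * (n : ℚ) + 19) / (4 * (n : ℚ) + 6) ∧
        colVar c 5 = (44 * (n : ℚ) ^ 3 + 626 * (n : ℚ) ^ 2 + 1292 * (n : ℚ) + 678)
          / (4 * (n : ℚ) + 6) ^ 3) := by
  constructor
  · rintro ⟨m, rfl⟩
    rw [← two_mul] at hn ⊢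
    let g : Fin (2 * m) → ℕ := fun i => 2 + i % 2
    have hg : ∀ i, 2 ≤ g i ∧ g i < 4 := fun i => by simp only [g]; lia
    have hsum (f : ℕ → ℚ) : ∑ i, f (g i) = m * (f 2 + f 3) :=
      (Fin.sum_univ_eq_sum_range (fun i => f (2 + i % 2)) _).trans
        (sum_range_two_mul_alternating f m)
    have hmean : colMean (mycielskianWheelColouring g 4) 4 =
        (7 * ((2 * m : ℕ) : ℚ) + 14) / (4 * ((2 * m : ℕ) : ℚ) + 6) := by
      rw [colMean, sum_mul_colClass_mycielskianWheelColouring (by norm_num) hg fun i => (i : ℚ),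
        hsum fun i => (i : ℚ), card_mycielskian_wheel]
      push_cast
      field_simp
      ring
    refine ⟨mycielskianWheelColouring g 4,
      mycielskianWheelColouring_mem_Icc (by norm_num) hg,
      mycielskianWheelColouring_ne_of_adj (by norm_num) hg fun i j hij => ?_, hmean, ?_⟩
    · simp only [g, ← hij, Nat.mod_mul_right_mod]
      lia
    · rw [colVar, hmean,
        sum_mul_colClass_mycielskianWheelColouring (by norm_num) hg fun i => (i : ℚ) ^ 2,
        hsum fun i => (i : ℚ) ^ 2, card_mycielskian_wheel]
      push_cast
      field_simp
      ring
  · rintro ⟨m, rfl⟩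
    let g : Fin (2 * m + 1) → ℕ := fun i => if (i : ℕ) = 2 * m then 4 else 2 + i % 2
    have hg : ∀ i, 2 ≤ g i ∧ g i < 5 := fun i => by simp only [g]; split_ifs <;> lia
    have hsum (f : ℕ → ℚ) : ∑ i, f (g i) = m * (f 2 + f 3) + f 4 :=
      (Fin.sum_univ_eq_sum_range (fun i => f (if i = 2 * m then 4 else 2 + i % 2)) _).trans
        (sum_range_alternating_last f m)
    have hmean : colMean (mycielskianWheelColouring g 5) 5 =
        (7 * ((2 * m + 1 : ℕ) : ℚ) + 19) / (4 * ((2 * m + 1 : ℕ) : ℚ) + 6) := by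
      rw [colMean, sum_mul_colClass_mycielskianWheelColouring (by norm_num) hg fun i => (i : ℚ),
        hsum fun i => (i : ℚ), card_mycielskian_wheel]
      push_cast
      field_simp
      ring
    refine ⟨mycielskianWheelColouring g 5,
      mycielskianWheelColouring_mem_Icc (by norm_num) hg,
      mycielskianWheelColouring_ne_of_adj (by norm_num) hg fun i j hij => ?_, hmean, ?_⟩
    · have hi := i.isLt
      simp only [g]
      rcases eq_or_ne (i : ℕ) (2 * m) with h | h
      · rw [h, Nat.mod_self] at hij
        split_ifs <;> lia
      · rw [Nat.mod_eq_of_lt (by lia)] at hij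
        split_ifs <;> lia
    · rw [colVar, hmean,
        sum_mul_colClass_mycielskianWheelColouring (by norm_num) hg fun i => (i : ℚ) ^ 2,
        hsum fun i => (i : ℚ) ^ 2, card_mycielskian_wheel]
      push_cast
      field_simp
      ring
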